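/- Let n ≥ 2, p > n − 2, M > 0 and D > 0. There exists a constant C > 0 depending only on n, p, M, D such that the following holds: for every bounded open convex set Ω ⊂ ℝⁿ with diam(Ω) = D, and every convex function u that is continuous on the closure of Ω, twice continuously differentiable in Ω, and satisfies det D²u(x) ≤ M·[dist(x, ∂Ω)]^p for all x ∈ Ω and u = 0 on ∂Ω, one has |u(x)| ≤ C · dist(x, ∂Ω) for all x ∈ Ω. -/

import Mathlib

open Metric MeasureTheory Real

/-- The Hessian matrix of `u : ℝⁿ → ℝ` at `x`, with entries the second partial
derivatives `∂²u/∂xᵢ∂xⱼ` computed via iterated Fréchet derivatives. -/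
noncomputable def hessianMatrix {n : ℕ} (u : EuclideanSpace ℝ (Fin n) → ℝ)
    (x : EuclideanSpace ℝ (Fin n)) : Matrix (Fin n) (Fin n) ℝ :=
  Matrix.of fun i j =>
    fderiv ℝ (fun y => fderiv ℝ u y (EuclideanSpace.single j 1)) x (EuclideanSpace.single i 1)

/-- The determinant of the Hessian matrix, `det D²u(x)`. -/
noncomputable def hessianDet {n : ℕ} (u : EuclideanSpace ℝ (Fin n) → ℝ)
    (x : EuclideanSpace ℝ (Fin n)) : ℝ := (hessianMatrix u x).det

/-- A symmetric real matrix whose quadratic form dominates `|x|²` has determinant at least `1`. -/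
lemma one_le_det_of_dotProduct_le {n : ℕ} {M : Matrix (Fin n) (Fin n) ℝ} (hM : M.IsHermitian)
    (h : ∀ x : Fin n → ℝ, x ⬝ᵥ x ≤ x ⬝ᵥ M.mulVec x) : 1 ≤ M.det := by
  rw [hM.det_eq_prod_eigenvalues]
  have key : ∀ i, 1 ≤ hM.eigenvalues i := by
    intro i
    have h1 := h (hM.eigenvectorBasis i)
    have h2 := hM.eigenvalues_eq i
    have h3 := hM.eigenvectorBasis.orthonormal.1 i
    have h4 : (hM.eigenvectorBasis i).ofLp ⬝ᵥ (hM.eigenvectorBasis i).ofLp = 1 := by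
      have h5 := real_inner_self_eq_norm_sq (hM.eigenvectorBasis i)
      rw [h3, EuclideanSpace.inner_eq_star_dotProduct] at h5
      simpa using h5
    simp only [star_trivial, RCLike.re_to_real] at h2
    rw [h2, ← h4]
    exact h1
  simpa using Finset.prod_le_prod (s := Finset.univ) (f := fun _ => (1 : ℝ))
    (g := fun i => hM.eigenvalues i) (fun _ _ => zero_le_one) fun i _ => key i

/-- If the quadratic form of a symmetric matrix `H` dominates `|U x|²`, then `det H` dominates
`(det U)²`. -/
lemma sq_det_le_det {n : ℕ} {U H : Matrix (Fin n) (Fin n) ℝ} (hU : IsUnit U.det)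
    (hH : H.IsHermitian)
    (h : ∀ x : Fin n → ℝ, U.mulVec x ⬝ᵥ U.mulVec x ≤ x ⬝ᵥ H.mulVec x) : U.det ^ 2 ≤ H.det := by
  have h1 : 1 ≤ (U⁻¹.conjTranspose * H * U⁻¹).det := by
    refine one_le_det_of_dotProduct_le (Matrix.isHermitian_conjTranspose_mul_mul _ hH) fun x => ?_
    have h2 := h (U⁻¹.mulVec x)
    rw [Matrix.mulVec_mulVec, Matrix.mul_nonsing_inv _ hU, Matrix.one_mulVec] at h2
    refine h2.trans_eq ?_
    rw [← Matrix.mulVec_mulVec, ← Matrix.mulVec_mulVec, Matrix.dotProduct_mulVec x,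
      Matrix.conjTranspose_eq_transpose_of_trivial, Matrix.vecMul_transpose]
  rw [Matrix.det_mul, Matrix.det_mul, Matrix.det_conjTranspose, Matrix.det_nonsing_inv,
    Ring.inverse_eq_inv'] at h1
  have h3 : U.det ≠ 0 := hU.ne_zero
  have h4 : 0 < U.det ^ 2 := by positivity
  have h5 : star U.det⁻¹ * H.det * U.det⁻¹ = H.det / U.det ^ 2 := by
    simp only [star_trivial]
    field_simp
  rw [h5, le_div_iff₀ h4] at h1
  linarith

/-- The second-order necessary condition at a local minimum. -/
lemma second_deriv_nonneg_of_isLocalMin {g g' : ℝ → ℝ} {x c : ℝ}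
    (hg : ∀ᶠ s in nhds x, HasDerivAt g (g' s) s) (hg' : HasDerivAt g' c x)
    (hmin : IsLocalMin g x) : 0 ≤ c := by
  by_contra! hc
  have hd : deriv g =ᶠ[nhds x] g' := hg.mono fun s hs => hs.deriv
  have hdd : deriv (deriv g) x = c := by rw [hd.deriv_eq, hg'.deriv]
  have hmax := isLocalMax_of_deriv_deriv_neg (by rw [hdd]; exact hc) hmin.deriv_eq_zero
    hg.self_of_nhds.continuousAt
  have hconst : g =ᶠ[nhds x] fun _ => g x := by
    filter_upwards [hmin, hmax] with s h1 h2 using le_antisymm h2 h1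
  have h0 : deriv (deriv g) x = 0 := by
    rw [hconst.deriv.deriv_eq]
    simp
  linarith

lemma eventually_hasDerivAt_line {n : ℕ} {u : EuclideanSpace ℝ (Fin n) → ℝ}
    {y : EuclideanSpace ℝ (Fin n)} (hu : ContDiffAt ℝ 2 u y) (ξ : EuclideanSpace ℝ (Fin n)) :
    ∀ᶠ s in nhds (0 : ℝ), HasDerivAt (fun s : ℝ => u (y + s • ξ)) (fderiv ℝ u (y + s • ξ) ξ) s := by
  have h1 : ∀ᶠ w in nhds y, DifferentiableAt ℝ u w :=
    (hu.eventually (by simp)).mono fun w hw => hw.differentiableAt (by simp)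
  have h2 : Filter.Tendsto (fun s : ℝ => y + s • ξ) (nhds 0) (nhds y) := by
    have : Continuous (fun s : ℝ => y + s • ξ) := by fun_prop
    simpa using this.tendsto 0
  filter_upwards [h2.eventually h1] with s hs
  have h3 : HasDerivAt (fun s : ℝ => y + s • ξ) ξ s := by
    simpa using ((hasDerivAt_id s).smul_const ξ).const_add y
  exact hs.hasFDerivAt.comp_hasDerivAt s h3

lemma hessianMatrix_apply {n : ℕ} {u : EuclideanSpace ℝ (Fin n) → ℝ}
    {y : EuclideanSpace ℝ (Fin n)} (hu : ContDiffAt ℝ 2 u y) (i j : Fin n) :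
    hessianMatrix u y i j =
      fderiv ℝ (fderiv ℝ u) y (EuclideanSpace.single i 1) (EuclideanSpace.single j 1) := by
  have h1 : DifferentiableAt ℝ (fderiv ℝ u) y :=
    (hu.fderiv_right (m := 1) (by norm_num)).differentiableAt (by simp)
  have h2 := (h1.hasFDerivAt.clm_apply (hasFDerivAt_const (EuclideanSpace.single j (1 : ℝ)) y))
  simp only [hessianMatrix, Matrix.of_apply]
  rw [h2.fderiv]
  simp

lemma isHermitian_hessianMatrix {n : ℕ} {u : EuclideanSpace ℝ (Fin n) → ℝ}
    {y : EuclideanSpace ℝ (Fin n)} (hu : ContDiffAt ℝ 2 u y) : (hessianMatrix u y).IsHermitian := by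
  ext i j
  rw [Matrix.conjTranspose_apply, hessianMatrix_apply hu, hessianMatrix_apply hu, star_trivial]
  exact hu.isSymmSndFDerivAt (by simp) _ _

lemma dotProduct_hessianMatrix_mulVec {n : ℕ} {u : EuclideanSpace ℝ (Fin n) → ℝ}
    {y : EuclideanSpace ℝ (Fin n)} (hu : ContDiffAt ℝ 2 u y) (ξ : EuclideanSpace ℝ (Fin n)) :
    ξ.ofLp ⬝ᵥ (hessianMatrix u y).mulVec ξ.ofLp = fderiv ℝ (fderiv ℝ u) y ξ ξ := by
  have hξ : ξ = ∑ i, ξ i • EuclideanSpace.single i (1 : ℝ) := by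
    ext k
    simp [Finset.sum_apply, Pi.single_apply]
  simp only [dotProduct, Matrix.mulVec, Finset.mul_sum, hessianMatrix_apply hu]
  generalize fderiv ℝ (fderiv ℝ u) y = B
  have h1 : B ξ ξ = B (∑ i, ξ i • EuclideanSpace.single i (1 : ℝ))
      (∑ i, ξ i • EuclideanSpace.single i (1 : ℝ)) := by rw [← hξ]
  rw [h1]
  simp only [map_sum, map_smul, sum_apply, smul_apply,
    smul_eq_mul, Finset.mul_sum]
  rw [Finset.sum_comm]
  refine Finset.sum_congr rfl fun i _ => Finset.sum_congr rfl fun j _ => by ring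

lemma hasDerivAt_fderiv_line {n : ℕ} {u : EuclideanSpace ℝ (Fin n) → ℝ}
    {y : EuclideanSpace ℝ (Fin n)} (hu : ContDiffAt ℝ 2 u y) (ξ : EuclideanSpace ℝ (Fin n)) :
    HasDerivAt (fun s : ℝ => fderiv ℝ u (y + s • ξ) ξ)
      (ξ.ofLp ⬝ᵥ (hessianMatrix u y).mulVec ξ.ofLp) 0 := by
  rw [dotProduct_hessianMatrix_mulVec hu]
  have h1 : DifferentiableAt ℝ (fderiv ℝ u) y :=
    (hu.fderiv_right (m := 1) (by norm_num)).differentiableAt (by simp)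
  have h2 : HasFDerivAt (fun w => fderiv ℝ u w ξ) ((fderiv ℝ (fderiv ℝ u) y).flip ξ)
      (y + (0 : ℝ) • ξ) := by
    rw [zero_smul, add_zero]
    refine (h1.hasFDerivAt.clm_apply (hasFDerivAt_const ξ y)).congr_fderiv ?_
    ext v
    simp
  have h3 : HasDerivAt (fun s : ℝ => y + s • ξ) ξ 0 := by
    simpa using ((hasDerivAt_id (0 : ℝ)).smul_const ξ).const_add y
  exact h2.comp_hasDerivAt 0 h3

lemma det_smul_one_add_vecMulVec {n : ℕ} (ν : Fin n → ℝ) (hν : ν ⬝ᵥ ν = 1) (c r : ℝ) :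
    (c • (1 + r • Matrix.vecMulVec ν ν)).det = c ^ n * (1 + r) := by
  rw [Matrix.det_smul, Fintype.card_fin, ← Matrix.smul_vecMulVec, Matrix.vecMulVec_eq Unit,
    Matrix.det_one_add_replicateCol_mul_replicateRow]
  simp [hν]

lemma dotProduct_smul_one_add_vecMulVec {n : ℕ} (ν ξ : Fin n → ℝ) (hν : ν ⬝ᵥ ν = 1) (c r : ℝ) :
    (c • (1 + r • Matrix.vecMulVec ν ν)).mulVec ξ ⬝ᵥ (c • (1 + r • Matrix.vecMulVec ν ν)).mulVec ξ
      = c ^ 2 * (ξ ⬝ᵥ ξ + ((1 + r) ^ 2 - 1) * (ν ⬝ᵥ ξ) ^ 2) := by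
  have h : (c • (1 + r • Matrix.vecMulVec ν ν)).mulVec ξ = c • (ξ + (r * (ν ⬝ᵥ ξ)) • ν) := by
    rw [Matrix.smul_mulVec, Matrix.add_mulVec, Matrix.one_mulVec, Matrix.smul_mulVec,
      Matrix.vecMulVec_mulVec]
    simp [smul_smul]
  rw [h]
  simp only [smul_dotProduct, dotProduct_smul, add_dotProduct, dotProduct_add, hν, smul_eq_mul,
    dotProduct_comm ξ ν]
  ring

/-- A continuous function that is convex in a bounded open set is nonpositive there if it vanishes
on the boundary. -/
lemma nonpos_of_convexOn {n : ℕ} (hn : 0 < n) {Ω : Set (EuclideanSpace ℝ (Fin n))}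
    {u : EuclideanSpace ℝ (Fin n) → ℝ} (hΩ : IsOpen Ω) (hb : Bornology.IsBounded Ω)
    (hc : ContinuousOn u (closure Ω)) (hu : ConvexOn ℝ Ω u) (h0 : ∀ x ∈ frontier Ω, u x = 0)
    {x : EuclideanSpace ℝ (Fin n)} (hx : x ∈ Ω) : u x ≤ 0 := by
  by_contra! hpos
  obtain ⟨R, hR⟩ := hb.closure.exists_norm_le
  have hR2 : ∀ y ∈ closure Ω, ‖y‖ ^ 2 ≤ R ^ 2 := fun y hy =>
    pow_le_pow_left₀ (norm_nonneg _) (hR y hy) 2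
  set ε : ℝ := u x / (R ^ 2 + 1) with hε
  have hε0 : 0 < ε := by positivity
  have hεR : ε * R ^ 2 < u x := by
    rw [hε, div_mul_eq_mul_div, div_lt_iff₀ (by positivity)]
    nlinarith
  have hcont : ContinuousOn (fun y => u y + ε * ‖y‖ ^ 2) (closure Ω) := hc.add (by fun_prop)
  obtain ⟨y, hy, hmax⟩ := hb.isCompact_closure.exists_isMaxOn ⟨x, subset_closure hx⟩ hcont
  have hxy : u x ≤ u y + ε * ‖y‖ ^ 2 := by
    have h : u x + ε * ‖x‖ ^ 2 ≤ u y + ε * ‖y‖ ^ 2 := hmax (subset_closure hx)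
    nlinarith [sq_nonneg ‖x‖]
  by_cases hyΩ : y ∈ Ω
  · set e : EuclideanSpace ℝ (Fin n) := EuclideanSpace.single ⟨0, hn⟩ 1
    have he : ‖e‖ = 1 := by simp [e]
    obtain ⟨δ, hδ, hball⟩ := Metric.isOpen_iff.mp hΩ y hyΩ
    have hnorm : ‖(δ / 2) • e‖ = δ / 2 := by
      rw [norm_smul, he, mul_one, Real.norm_of_nonneg (by positivity)]
    have h1 : y + (δ / 2) • e ∈ Ω := hball (by
      rw [mem_ball_iff_norm, add_sub_cancel_left, hnorm]; linarith)
    have h2 : y - (δ / 2) • e ∈ Ω := hball (by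
      rw [mem_ball_iff_norm, sub_sub_cancel_left, norm_neg, hnorm]; linarith)
    have h3 := hu.2 h1 h2 (by norm_num : (0 : ℝ) ≤ 1 / 2) (by norm_num : (0 : ℝ) ≤ 1 / 2)
      (by norm_num)
    have h4 : (1 / 2 : ℝ) • (y + (δ / 2) • e) + (1 / 2 : ℝ) • (y - (δ / 2) • e) = y := by module
    rw [h4] at h3
    simp only [smul_eq_mul] at h3
    have h5 : u (y + (δ / 2) • e) + ε * ‖y + (δ / 2) • e‖ ^ 2 ≤ u y + ε * ‖y‖ ^ 2 :=
      hmax (subset_closure h1)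
    have h6 : u (y - (δ / 2) • e) + ε * ‖y - (δ / 2) • e‖ ^ 2 ≤ u y + ε * ‖y‖ ^ 2 :=
      hmax (subset_closure h2)
    have h7 := parallelogram_law_with_norm ℝ y ((δ / 2) • e)
    rw [hnorm] at h7
    have h8 : 0 < ε * δ ^ 2 := by positivity
    have h9 : ε * ‖y + (δ / 2) • e‖ ^ 2 + ε * ‖y - (δ / 2) • e‖ ^ 2
        = ε * (2 * (‖y‖ ^ 2 + (δ / 2) ^ 2)) := by
      linear_combination ε * h7
    linarith
  · have hyf : y ∈ frontier Ω := by rw [hΩ.frontier_eq]; exact ⟨hy, hyΩ⟩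
    rw [h0 y hyf] at hxy
    nlinarith [hR2 y hy]

/-- A boundary point of an open convex set has a unit inner normal. -/
lemma exists_unit_normal {n : ℕ} {Ω : Set (EuclideanSpace ℝ (Fin n))} (hΩ : IsOpen Ω)
    (hcv : Convex ℝ Ω) (hne : Ω.Nonempty) {z : EuclideanSpace ℝ (Fin n)} (hz : z ∉ Ω) :
    ∃ ν : EuclideanSpace ℝ (Fin n), ‖ν‖ = 1 ∧ ∀ y ∈ Ω, 0 < inner ℝ ν (y - z) := by
  obtain ⟨f, hf⟩ := geometric_hahn_banach_point_open hcv hΩ hz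
  set w := (InnerProductSpace.toDual ℝ (EuclideanSpace ℝ (Fin n))).symm f
  have hw : ∀ y, inner ℝ w y = f y := fun y => InnerProductSpace.toDual_symm_apply
  have hw0 : w ≠ 0 := by
    intro h
    obtain ⟨y, hy⟩ := hne
    have h1 := hf y hy
    rw [← hw, ← hw, h] at h1
    simp at h1
  refine ⟨‖w‖⁻¹ • w, norm_smul_inv_norm hw0, fun y hy => ?_⟩
  rw [inner_smul_left, hw, map_sub]
  have := hf y hy
  have h2 : 0 < ‖w‖ := norm_pos_iff.mpr hw0
  simp only [conj_trivial]
  exact mul_pos (inv_pos.mpr h2) (by linarith)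

/-- The distance to the boundary is at most the height above a supporting hyperplane. -/
lemma infDist_frontier_le_inner {n : ℕ} {Ω : Set (EuclideanSpace ℝ (Fin n))}
    {ν z : EuclideanSpace ℝ (Fin n)} (hν : ‖ν‖ = 1) (h : ∀ y ∈ Ω, 0 < inner ℝ ν (y - z))
    {y : EuclideanSpace ℝ (Fin n)} (hy : y ∈ Ω) :
    infDist y (frontier Ω) ≤ inner ℝ ν (y - z) := by
  set t := inner ℝ ν (y - z) with ht
  have hq : y - t • ν ∉ Ω := by
    intro hq
    have h1 := h _ hq
    rw [sub_right_comm, inner_sub_right, inner_smul_right, real_inner_self_eq_norm_sq, hν,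
      ← ht] at h1
    simp at h1
  obtain ⟨w, hw, hd⟩ := exists_mem_frontier_infDist_compl_eq_dist hy
    (fun huniv => hq (huniv ▸ Set.mem_univ _))
  calc infDist y (frontier Ω) ≤ dist y w := infDist_le_dist_of_mem hw
    _ = infDist y Ωᶜ := hd.symm
    _ ≤ dist y (y - t • ν) := infDist_le_dist_of_mem hq
    _ = t := by
      rw [dist_eq_norm, sub_sub_cancel, norm_smul, hν, mul_one, Real.norm_of_nonneg (h y hy).le]

/-- The barrier `A tᵃ (|y'|² + K) - L t`, where `t` is the height of `y` above the hyperplane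
through `z` with unit normal `ν` and `y'` is the tangential part of `y - z`. -/
noncomputable def barrier {n : ℕ} (a K A L : ℝ) (ν z y : EuclideanSpace ℝ (Fin n)) : ℝ :=
  A * ((inner ℝ ν (y - z)) ^ a * (‖y - z‖ ^ 2 - (inner ℝ ν (y - z)) ^ 2 + K)) -
    L * inner ℝ ν (y - z)

lemma barrier_line {n : ℕ} (a K A L : ℝ) (ν z y ξ : EuclideanSpace ℝ (Fin n)) (s : ℝ) :
    barrier a K A L ν z (y + s • ξ) =
      A * ((inner ℝ ν (y - z) + s * inner ℝ ν ξ) ^ a *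
        (‖y - z‖ ^ 2 + 2 * s * inner ℝ (y - z) ξ + s ^ 2 * ‖ξ‖ ^ 2 -
          (inner ℝ ν (y - z) + s * inner ℝ ν ξ) ^ 2 + K)) -
        L * (inner ℝ ν (y - z) + s * inner ℝ ν ξ) := by
  have h1 : y + s • ξ - z = (y - z) + s • ξ := by abel
  have h2 : ‖(y - z) + s • ξ‖ ^ 2 = ‖y - z‖ ^ 2 + 2 * s * inner ℝ (y - z) ξ + s ^ 2 * ‖ξ‖ ^ 2 := by
    rw [norm_add_sq_real, inner_smul_right, norm_smul, mul_pow, Real.norm_eq_abs, sq_abs]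
    ring
  rw [barrier, h1, h2, inner_add_right, inner_smul_right]

lemma hasDerivAt_barrier_profile (a K A L t σ Y b e s : ℝ) (hs : 0 < t + s * σ) :
    HasDerivAt (fun s : ℝ => A * ((t + s * σ) ^ a *
        (Y + 2 * s * b + s ^ 2 * e - (t + s * σ) ^ 2 + K)) - L * (t + s * σ))
      (A * (σ * a * (t + s * σ) ^ (a - 1) * (Y + 2 * s * b + s ^ 2 * e - (t + s * σ) ^ 2 + K) +
        (t + s * σ) ^ a * (2 * b + 2 * s * e - 2 * σ * (t + s * σ))) - L * σ) s := by
  have h1 : HasDerivAt (fun s : ℝ => t + s * σ) σ s := by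
    simpa using ((hasDerivAt_id s).mul_const σ).const_add t
  have h2 := h1.rpow_const (p := a) (Or.inl hs.ne')
  have h3 : HasDerivAt (fun s : ℝ => Y + 2 * s * b + s ^ 2 * e - (t + s * σ) ^ 2 + K)
      (2 * b + 2 * s * e - 2 * σ * (t + s * σ)) s := by
    have h4 := (((((hasDerivAt_id s).const_mul 2).mul_const b).const_add Y).add
      (((hasDerivAt_id s).pow 2).mul_const e)).sub (h1.pow 2) |>.add_const K
    refine h4.congr_deriv ?_
    simp
    ring
  exact ((h2.mul h3).const_mul A).sub (h1.const_mul L)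

lemma hasDerivAt_barrier_profile_deriv (a K A L t σ Y b e : ℝ) (ht : 0 < t) :
    HasDerivAt (fun s : ℝ => A * (σ * a * (t + s * σ) ^ (a - 1) *
        (Y + 2 * s * b + s ^ 2 * e - (t + s * σ) ^ 2 + K) +
        (t + s * σ) ^ a * (2 * b + 2 * s * e - 2 * σ * (t + s * σ))) - L * σ)
      (A * t ^ a / t ^ 2 * (a * (a - 1) * σ ^ 2 * (Y - t ^ 2 + K) + 4 * a * σ * t * (b - σ * t) +
        2 * t ^ 2 * (e - σ ^ 2))) 0 := by
  have h1 : HasDerivAt (fun s : ℝ => t + s * σ) σ 0 := by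
    simpa using ((hasDerivAt_id (0 : ℝ)).mul_const σ).const_add t
  have h2 := h1.rpow_const (p := a) (Or.inl (by simpa using ht.ne'))
  have h2' := h1.rpow_const (p := a - 1) (Or.inl (by simpa using ht.ne'))
  have h3 : HasDerivAt (fun s : ℝ => Y + 2 * s * b + s ^ 2 * e - (t + s * σ) ^ 2 + K)
      (2 * b - 2 * σ * t) 0 := by
    have h4 := (((((hasDerivAt_id (0 : ℝ)).const_mul 2).mul_const b).const_add Y).add
      (((hasDerivAt_id (0 : ℝ)).pow 2).mul_const e)).sub (h1.pow 2) |>.add_const K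
    refine h4.congr_deriv ?_
    simp
    ring
  have h5 : HasDerivAt (fun s : ℝ => 2 * b + 2 * s * e - 2 * σ * (t + s * σ))
      (2 * e - 2 * σ * σ) 0 := by
    have h4 := ((((hasDerivAt_id (0 : ℝ)).const_mul 2).mul_const e).const_add (2 * b)).sub
      (h1.const_mul (2 * σ))
    refine h4.congr_deriv ?_
    simp
  have h6 := ((((h2'.const_mul (σ * a)).mul h3).add (h2.mul h5)).const_mul A).sub_const (L * σ)
  refine h6.congr_deriv ?_
  have e1 : t ^ (a - 1) = t ^ a / t := by rw [Real.rpow_sub_one ht.ne']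
  have e2 : t ^ (a - 1 - 1) = t ^ a / t ^ 2 := by
    rw [Real.rpow_sub_one ht.ne', e1, div_div, sq]
  simp only [zero_mul, add_zero, mul_zero, e1, e2, ne_eq, OfNat.ofNat_ne_zero, not_false_eq_true,
    zero_pow]
  field_simp
  ring

/-- Lower bound for the second derivatives of the barrier. -/
lemma barrier_second_deriv_ge {n : ℕ} {a K D : ℝ} (ha : 1 < a)
    (hK : 4 * a ^ 2 * D ^ 2 + 1 ≤ a * (a - 1) * K) {ν w : EuclideanSpace ℝ (Fin n)}
    (hν : ‖ν‖ = 1) (hw : ‖w‖ ≤ D) (ξ : EuclideanSpace ℝ (Fin n)) :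
    (inner ℝ ν w) ^ 2 * (‖ξ‖ ^ 2 - (inner ℝ ν ξ) ^ 2) + (inner ℝ ν ξ) ^ 2 ≤
      a * (a - 1) * (inner ℝ ν ξ) ^ 2 * (‖w‖ ^ 2 - (inner ℝ ν w) ^ 2 + K) +
        4 * a * (inner ℝ ν ξ) * (inner ℝ ν w) * (inner ℝ w ξ - inner ℝ ν ξ * inner ℝ ν w) +
        2 * (inner ℝ ν w) ^ 2 * (‖ξ‖ ^ 2 - (inner ℝ ν ξ) ^ 2) := by
  set t := inner ℝ ν w with ht
  set σ := inner ℝ ν ξ with hσ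
  have ht2 : t ^ 2 ≤ ‖w‖ ^ 2 := by
    have h := abs_real_inner_le_norm ν w
    rw [hν, one_mul, ← ht] at h
    exact sq_le_sq.mpr (by rwa [abs_norm])
  have hw2 : ‖w‖ ^ 2 ≤ D ^ 2 := pow_le_pow_left₀ (norm_nonneg _) hw 2
  have hsq : ‖t • (ξ - σ • ν) + (2 * a * σ) • (w - t • ν)‖ ^ 2 =
      t ^ 2 * (‖ξ‖ ^ 2 - σ ^ 2) + 4 * a * σ * t * (inner ℝ w ξ - σ * t) +
        4 * a ^ 2 * σ ^ 2 * (‖w‖ ^ 2 - t ^ 2) := by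
    rw [← real_inner_self_eq_norm_sq, ← real_inner_self_eq_norm_sq ξ,
      ← real_inner_self_eq_norm_sq w]
    have hνν : inner ℝ ν ν = (1 : ℝ) := by rw [real_inner_self_eq_norm_sq, hν, one_pow]
    simp only [inner_add_left, inner_add_right, inner_sub_left, inner_sub_right,
      real_inner_smul_left, real_inner_smul_right, hνν, real_inner_comm ν ξ, real_inner_comm ν w,
      real_inner_comm w ξ, ← ht, ← hσ]
    ring
  have h0 := sq_nonneg ‖t • (ξ - σ • ν) + (2 * a * σ) • (w - t • ν)‖
  rw [hsq] at h0
  have h1 : 0 ≤ a * (a - 1) * σ ^ 2 * (‖w‖ ^ 2 - t ^ 2) :=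
    mul_nonneg (mul_nonneg (mul_nonneg (by linarith) (by linarith)) (sq_nonneg _)) (by linarith)
  have h2 : σ ^ 2 * (4 * a ^ 2 * D ^ 2 + 1) ≤ σ ^ 2 * (a * (a - 1) * K) :=
    mul_le_mul_of_nonneg_left hK (sq_nonneg _)
  have h3 : 4 * a ^ 2 * σ ^ 2 * (‖w‖ ^ 2 - t ^ 2) ≤ 4 * a ^ 2 * σ ^ 2 * D ^ 2 :=
    mul_le_mul_of_nonneg_left (by nlinarith) (by positivity)
  linarith

/-- At a local minimum of `u - barrier` the Hessian determinant of `u` dominates the lower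
bound for that of the barrier. -/
lemma le_hessianDet_of_isLocalMin {n : ℕ} {a K A L D : ℝ} (ha : 1 < a) (hA : 0 < A)
    (hK : 4 * a ^ 2 * D ^ 2 + 1 ≤ a * (a - 1) * K) {u : EuclideanSpace ℝ (Fin n) → ℝ}
    {ν z y : EuclideanSpace ℝ (Fin n)} (hν : ‖ν‖ = 1) (hyz : ‖y - z‖ ≤ D)
    (ht : 0 < inner ℝ ν (y - z)) (hu : ContDiffAt ℝ 2 u y)
    (hmin : IsLocalMin (fun w => u w - barrier a K A L ν z w) y) :
    A ^ n * (inner ℝ ν (y - z)) ^ (a * n - 2) ≤ hessianDet u y := by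
  set t := inner ℝ ν (y - z) with htdef
  have hta : 0 < t ^ a := Real.rpow_pos_of_pos ht a
  set c := √(A * t ^ a) with hc
  have hc2 : c ^ 2 = A * t ^ a := Real.sq_sqrt (by positivity)
  have hcpos : 0 < c := Real.sqrt_pos.mpr (by positivity)
  have hνν : ν.ofLp ⬝ᵥ ν.ofLp = 1 := by
    have h := real_inner_self_eq_norm_sq ν
    rw [hν, EuclideanSpace.inner_eq_star_dotProduct] at h
    simpa using h
  set U : Matrix (Fin n) (Fin n) ℝ := c • (1 + (1 / t - 1) • Matrix.vecMulVec ν.ofLp ν.ofLp)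
  have hdet : U.det = c ^ n * (1 / t) := by
    rw [det_smul_one_add_vecMulVec _ hνν, add_sub_cancel]
  have hquad : ∀ x : Fin n → ℝ,
      U.mulVec x ⬝ᵥ U.mulVec x ≤ x ⬝ᵥ (hessianMatrix u y).mulVec x := by
    intro x
    rw [dotProduct_smul_one_add_vecMulVec _ _ hνν]
    set ξ : EuclideanSpace ℝ (Fin n) := WithLp.toLp 2 x with hξ
    have e1 : x ⬝ᵥ x = ‖ξ‖ ^ 2 := by
      rw [← real_inner_self_eq_norm_sq, EuclideanSpace.inner_eq_star_dotProduct]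
      simp [hξ]
    have e2 : ν.ofLp ⬝ᵥ x = inner ℝ ν ξ := by
      rw [EuclideanSpace.inner_eq_star_dotProduct, dotProduct_comm]
      simp [hξ]
    have hpos : ∀ᶠ s in nhds (0 : ℝ), 0 < t + s * inner ℝ ν ξ := by
      have hcts : Continuous (fun s : ℝ => t + s * inner ℝ ν ξ) := by fun_prop
      exact hcts.continuousAt.eventually (lt_mem_nhds (by simpa using ht))
    have hline : Filter.Tendsto (fun s : ℝ => y + s • ξ) (nhds 0) (nhds y) := by
      have : Continuous (fun s : ℝ => y + s • ξ) := by fun_prop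
      simpa using this.tendsto 0
    have hmin' : IsLocalMin (fun s : ℝ => u (y + s • ξ) - barrier a K A L ν z (y + s • ξ)) 0 := by
      have h := hline.eventually hmin
      refine h.mono fun s hs => ?_
      simpa using hs
    have h := second_deriv_nonneg_of_isLocalMin
      (((eventually_hasDerivAt_line hu ξ).and hpos).mono fun s hs =>
        hs.1.sub ((hasDerivAt_barrier_profile a K A L t (inner ℝ ν ξ) (‖y - z‖ ^ 2)
          (inner ℝ (y - z) ξ) (‖ξ‖ ^ 2) s hs.2).congr_of_eventuallyEq
            (Filter.Eventually.of_forall fun s => barrier_line a K A L ν z y ξ s)))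
      ((hasDerivAt_fderiv_line hu ξ).sub (hasDerivAt_barrier_profile_deriv a K A L t
        (inner ℝ ν ξ) (‖y - z‖ ^ 2) (inner ℝ (y - z) ξ) (‖ξ‖ ^ 2) ht)) hmin'
    have hb := mul_le_mul_of_nonneg_left (barrier_second_deriv_ge ha hK hν hyz ξ)
      (by positivity : 0 ≤ A * t ^ a / t ^ 2)
    rw [← htdef] at hb
    rw [e1, e2, hc2]
    have e3 : A * t ^ a * (‖ξ‖ ^ 2 + ((1 + (1 / t - 1)) ^ 2 - 1) * inner ℝ ν ξ ^ 2) =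
        A * t ^ a / t ^ 2 * (t ^ 2 * (‖ξ‖ ^ 2 - inner ℝ ν ξ ^ 2) + inner ℝ ν ξ ^ 2) := by
      field_simp
      ring
    rw [e3]
    exact hb.trans (sub_nonneg.mp h)
  have hle := sq_det_le_det (by rw [hdet]; exact (by positivity : c ^ n * (1 / t) ≠ 0).isUnit)
    (isHermitian_hessianMatrix hu) hquad
  rw [hessianDet]
  refine le_trans (le_of_eq ?_) hle
  rw [hdet, mul_pow, ← pow_mul, mul_comm n 2, pow_mul, hc2, mul_pow, Real.rpow_sub ht,
    Real.rpow_mul ht.le, Real.rpow_natCast, Real.rpow_two]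
  field_simp

/-- Global Lipschitz estimate for convex subsolutions of
`det D²u ≤ M dist(·,∂Ω)^p`, `p > n-2`, vanishing on the boundary. -/
theorem stmt_1 (n : ℕ) (hn : 2 ≤ n) (p M D : ℝ)
    (hp : (n : ℝ) - 2 < p) (hM : 0 < M) (hD : 0 < D) :
    ∃ C : ℝ, 0 < C ∧
      ∀ (Ω : Set (EuclideanSpace ℝ (Fin n))) (u : EuclideanSpace ℝ (Fin n) → ℝ),
        IsOpen Ω → Bornology.IsBounded Ω → Convex ℝ Ω →
        Metric.diam Ω = D →
        ContinuousOn u (closure Ω) → ContDiffOn ℝ 2 u Ω → ConvexOn ℝ Ω u →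
        (∀ x ∈ Ω, hessianDet u x ≤ M * infDist x (frontier Ω) ^ p) →
        (∀ x ∈ frontier Ω, u x = 0) →
        ∀ x ∈ Ω, |u x| ≤ C * infDist x (frontier Ω) := by
  have hn2 : (2 : ℝ) ≤ n := by exact_mod_cast hn
  set a : ℝ := (p + 2) / n with ha_def
  have ha : 1 < a := by rw [ha_def, lt_div_iff₀ (by linarith)]; linarith
  have han : a * n - 2 = p := by rw [ha_def]; field_simp; ring
  have haa : 0 < a * (a - 1) := mul_pos (by linarith) (by linarith)
  set K : ℝ := (4 * a ^ 2 * D ^ 2 + 1) / (a * (a - 1)) with hK_def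
  have hK : 4 * a ^ 2 * D ^ 2 + 1 ≤ a * (a - 1) * K := by
    rw [hK_def, mul_div_cancel₀ _ haa.ne']
  have hK0 : 0 < K := by positivity
  set A : ℝ := M + 1 with hA_def
  have hA : 0 < A := by linarith
  have hAn : M < A ^ n := by
    have := le_self_pow₀ (by linarith : 1 ≤ A) (by omega : n ≠ 0)
    linarith
  set L : ℝ := A * (D ^ (a - 1) * (D ^ 2 + K)) with hL_def
  have hL : 0 < L := by
    have : 0 < D ^ (a - 1) := Real.rpow_pos_of_pos hD _
    positivity
  refine ⟨L, hL, fun Ω u hΩ hb hcv hdiam hcont hC2 hconv hdet hbdry x hx => ?_⟩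
  have hne : Ω.Nonempty := ⟨x, hx⟩
  have : Nonempty (Fin n) := ⟨⟨0, by omega⟩⟩
  have hfne : (frontier Ω).Nonempty := by
    rw [nonempty_frontier_iff]
    refine ⟨hne, fun huniv => ?_⟩
    rw [huniv] at hb
    exact NormedSpace.unbounded_univ ℝ (EuclideanSpace ℝ (Fin n)) hb
  obtain ⟨z, hz, hxz⟩ := isClosed_frontier.exists_infDist_eq_dist hfne x
  have hzΩ : z ∉ Ω := by rw [hΩ.frontier_eq] at hz; exact hz.2
  obtain ⟨ν, hν, hpos⟩ := exists_unit_normal hΩ hcv hne hzΩ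
  have hdist : ∀ y ∈ closure Ω, ‖y - z‖ ≤ D := by
    intro y hy
    rw [← dist_eq_norm, ← hdiam, ← Metric.diam_closure]
    exact dist_le_diam_of_mem hb.closure hy (frontier_subset_closure hz)
  have htD : ∀ y, inner ℝ ν (y - z) ≤ ‖y - z‖ := by
    intro y
    have := real_inner_le_norm ν (y - z)
    rwa [hν, one_mul] at this
  have ht0 : ∀ y ∈ closure Ω, 0 ≤ inner ℝ ν (y - z) := by
    have hsub : closure Ω ⊆ {y | 0 ≤ inner ℝ ν (y - z)} :=
      closure_minimal (fun y hy => (hpos y hy).le)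
        (isClosed_le continuous_const (by fun_prop))
    exact hsub
  have hbar : ∀ y ∈ closure Ω, barrier a K A L ν z y ≤ 0 := by
    intro y hy
    have h0 := ht0 y hy
    have h1 := htD y
    have h2 := hdist y hy
    rw [barrier, hL_def]
    set t := inner ℝ ν (y - z)
    have h3 : t ^ a = t ^ (a - 1) * t := by
      rcases h0.eq_or_lt with h | h
      · rw [← h, mul_zero, Real.zero_rpow (by linarith)]
      · rw [Real.rpow_sub_one h.ne']; field_simp
    have h4 : t ^ (a - 1) ≤ D ^ (a - 1) :=
      Real.rpow_le_rpow h0 (h1.trans h2) (by linarith)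
    have h5 : ‖y - z‖ ^ 2 ≤ D ^ 2 := pow_le_pow_left₀ (norm_nonneg _) h2 2
    have h6 : t ^ 2 ≤ ‖y - z‖ ^ 2 := pow_le_pow_left₀ h0 h1 2
    have h7 : t ^ (a - 1) * (‖y - z‖ ^ 2 - t ^ 2 + K) ≤ D ^ (a - 1) * (D ^ 2 + K) :=
      mul_le_mul h4 (by nlinarith) (by linarith) (by positivity)
    have h8 := mul_le_mul_of_nonneg_left h7 (by positivity : 0 ≤ A * t)
    rw [h3]
    linarith
  have hcmp : ∀ y ∈ closure Ω, barrier a K A L ν z y ≤ u y := by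
    have hbc : Continuous (barrier a K A L ν z) := by
      have : Continuous fun y : EuclideanSpace ℝ (Fin n) => (inner ℝ ν (y - z)) ^ a :=
        Continuous.rpow_const (by fun_prop) fun _ => Or.inr (by linarith)
      unfold barrier
      fun_prop
    obtain ⟨y, hy, hmin⟩ := hb.isCompact_closure.exists_isMinOn hne.closure
      (hcont.sub hbc.continuousOn)
    have hy0 : 0 ≤ u y - barrier a K A L ν z y := by
      by_cases hyΩ : y ∈ Ω
      · exfalso
        have hnhds : closure Ω ∈ nhds y := Filter.mem_of_superset (hΩ.mem_nhds hyΩ) subset_closure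
        have h1 := le_hessianDet_of_isLocalMin ha hA hK hν (hdist y hy) (hpos y hyΩ)
          (hC2.contDiffAt (hΩ.mem_nhds hyΩ)) (hmin.isLocalMin hnhds)
        rw [han] at h1
        have h2 : infDist y (frontier Ω) ^ p ≤ (inner ℝ ν (y - z)) ^ p :=
          Real.rpow_le_rpow infDist_nonneg (infDist_frontier_le_inner hν hpos hyΩ) (by linarith)
        have h3 : 0 < (inner ℝ ν (y - z)) ^ p := Real.rpow_pos_of_pos (hpos y hyΩ) p
        have h4 := hdet y hyΩ
        have h5 := mul_le_mul_of_nonneg_left h2 hM.le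
        have h6 := mul_lt_mul_of_pos_right hAn h3
        linarith
      · rw [hbdry y (by rw [hΩ.frontier_eq]; exact ⟨hy, hyΩ⟩)]
        linarith [hbar y hy]
    intro w hw
    have h : u y - barrier a K A L ν z y ≤ u w - barrier a K A L ν z w := hmin hw
    linarith
  have hu0 := nonpos_of_convexOn (by omega) hΩ hb hcont hconv hbdry hx
  rw [abs_of_nonpos hu0]
  have h1 := hcmp x (subset_closure hx)
  have h2 : -(L * infDist x (frontier Ω)) ≤ barrier a K A L ν z x := by
    have h3 := htD x
    have h4 := hpos x hx
    rw [barrier, hxz, dist_eq_norm]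
    have h5 : inner ℝ ν (x - z) ^ 2 ≤ ‖x - z‖ ^ 2 := pow_le_pow_left₀ h4.le h3 2
    have h6 : 0 ≤ A * (inner ℝ ν (x - z) ^ a * (‖x - z‖ ^ 2 - inner ℝ ν (x - z) ^ 2 + K)) :=
      mul_nonneg hA.le (mul_nonneg (Real.rpow_nonneg h4.le _) (by linarith))
    have h7 := mul_le_mul_of_nonneg_left h3 hL.le
    linarith
  linarith
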